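/- Let $\xi_{k,j,n}$ be random variables such that for each $n$ the $\sigma$-algebras $\sigma(\xi_{k,j,n} : k \in \mathbb{N})$, $j \in \mathbb{N}$, are independent, and $\sup_{k,j,n} \mathbb{E}[\xi_{k,j,n}^4] < \infty$. Let $K_n = nK + o(n)$ with $K > 0$. Then $n^{-1} \sum_{k=1}^{K_n} k^{-1} \left[ \sum_{j=1}^{k} \xi_{k,j,n} - \mathbb{E}\sum_{j=1}^{k} \xi_{k,j,n} \right] \to 0$ almost surely as $n \to \infty$. -/

import Mathlib

open MeasureTheory ProbabilityTheory Filter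

theorem aux_add4 (a b : ℝ) : (a + b) ^ 4 ≤ 8 * (a ^ 4 + b ^ 4) := by
  nlinarith [sq_nonneg (a - b), sq_nonneg (a ^ 2 - b ^ 2), sq_nonneg ((a - b) * (a + b)),
    sq_nonneg ((a - b) ^ 2), mul_nonneg (sq_nonneg (a - b)) (sq_nonneg (a + b)),
    mul_nonneg (sq_nonneg (a - b)) (sq_nonneg a), mul_nonneg (sq_nonneg (a - b)) (sq_nonneg b)]

theorem aux_abs_pow (x : ℝ) (i : ℕ) (hi : i ≤ 4) : |x ^ i| ≤ 1 + x ^ 4 := by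
  have h4 : x ^ 4 = |x| ^ 4 := by rw [← abs_pow]; exact (abs_of_nonneg (by positivity)).symm
  rw [abs_pow, h4]
  rcases le_total |x| 1 with h | h
  · have := pow_le_one₀ (n := i) (abs_nonneg x) h
    have : 0 ≤ |x| ^ 4 := by positivity
    linarith
  · have := pow_le_pow_right₀ h hi
    linarith

section Aux

variable {Ω : Type*} [MeasureSpace Ω] [IsProbabilityMeasure (ℙ : Measure Ω)]

theorem aux_int_pow {f : Ω → ℝ} (hf : Measurable f)
    (h4 : Integrable (fun ω => f ω ^ 4) ℙ) (i : ℕ) (hi : i ≤ 4) :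
    Integrable (fun ω => f ω ^ i) ℙ := by
  refine Integrable.mono' ((integrable_const (1 : ℝ)).add h4) (by fun_prop) ?_
  exact Eventually.of_forall fun ω => aux_abs_pow _ i hi

theorem aux_int_add {f g : Ω → ℝ} (hf : Measurable f) (hg : Measurable g)
    (h4 : Integrable (fun ω => f ω ^ 4) ℙ) (h4' : Integrable (fun ω => g ω ^ 4) ℙ) :
    Integrable (fun ω => (f ω + g ω) ^ 4) ℙ := by
  refine Integrable.mono' ((h4.add h4').const_mul 8) (by fun_prop) ?_
  refine Eventually.of_forall fun ω => ?_
  rw [Real.norm_of_nonneg (by positivity)]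
  exact aux_add4 _ _

theorem aux_step {S X : Ω → ℝ} (hS : Measurable S) (hX : Measurable X)
    (hS4 : Integrable (fun ω => S ω ^ 4) ℙ) (hX4 : Integrable (fun ω => X ω ^ 4) ℙ)
    (hi : IndepFun S X ℙ) (hS0 : ∫ ω, S ω ∂ℙ = 0) (hX0 : ∫ ω, X ω ∂ℙ = 0) :
    ∫ ω, (S ω + X ω) ∂ℙ = 0 ∧
    ∫ ω, (S ω + X ω) ^ 2 ∂ℙ = ∫ ω, S ω ^ 2 ∂ℙ + ∫ ω, X ω ^ 2 ∂ℙ ∧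
    ∫ ω, (S ω + X ω) ^ 4 ∂ℙ = ∫ ω, S ω ^ 4 ∂ℙ + 6 * ((∫ ω, S ω ^ 2 ∂ℙ) * ∫ ω, X ω ^ 2 ∂ℙ)
      + ∫ ω, X ω ^ 4 ∂ℙ := by
  have iS := aux_int_pow hS hS4
  have iX := aux_int_pow hX hX4
  have hI : ∀ a b : ℕ, IndepFun (fun ω => S ω ^ a) (fun ω => X ω ^ b) ℙ := fun a b =>
    hi.comp (φ := fun x : ℝ => x ^ a) (ψ := fun x : ℝ => x ^ b)
      (measurable_id.pow_const a) (measurable_id.pow_const b)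
  have hP : ∀ a b : ℕ, a ≤ 4 → b ≤ 4 → Integrable (fun ω => S ω ^ a * X ω ^ b) ℙ :=
    fun a b ha hb => (hI a b).integrable_mul (iS a ha) (iX b hb)
  have hE : ∀ a b : ℕ, ∫ ω, S ω ^ a * X ω ^ b ∂ℙ = (∫ ω, S ω ^ a ∂ℙ) * ∫ ω, X ω ^ b ∂ℙ :=
    fun a b => (hI a b).integral_fun_mul_eq_mul_integral
      (by fun_prop) (by fun_prop)
  have hS1 : Integrable S ℙ := by simpa using iS 1 (by norm_num)
  have hX1 : Integrable X ℙ := by simpa using iX 1 (by norm_num)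
  have e11 := hE 1 1
  have e31 := hE 3 1
  have e13 := hE 1 3
  have e22 := hE 2 2
  simp only [pow_one] at e11 e31 e13
  have p11 := hP 1 1 (by norm_num) (by norm_num)
  have p31 := hP 3 1 (by norm_num) (by norm_num)
  have p13 := hP 1 3 (by norm_num) (by norm_num)
  have p22 := hP 2 2 (by norm_num) (by norm_num)
  simp only [pow_one] at p11 p31 p13
  have s2 := iS 2 (by norm_num)
  have x2 := iX 2 (by norm_num)
  refine ⟨?_, ?_, ?_⟩
  · rw [integral_add hS1 hX1, hS0, hX0, add_zero]
  · have : (fun ω => (S ω + X ω) ^ 2) = fun ω => (S ω ^ 2 + 2 * (S ω * X ω)) + X ω ^ 2 := by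
      funext ω; ring
    rw [this, integral_add (s2.fun_add (p11.const_mul 2)) x2, integral_add s2 (p11.const_mul 2),
      integral_const_mul, e11, hS0]
    ring
  · have : (fun ω => (S ω + X ω) ^ 4) = fun ω => (((S ω ^ 4 + 4 * (S ω ^ 3 * X ω))
        + 6 * (S ω ^ 2 * X ω ^ 2)) + 4 * (S ω * X ω ^ 3)) + X ω ^ 4 := by
      funext ω; ring
    have q1 := hS4.fun_add (p31.const_mul 4)
    have q2 := q1.fun_add (p22.const_mul 6)
    have q3 := q2.fun_add (p13.const_mul 4)
    rw [this, integral_add q3 hX4, integral_add q2 (p13.const_mul 4),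
      integral_add q1 (p22.const_mul 6), integral_add hS4 (p31.const_mul 4),
      integral_const_mul, integral_const_mul, integral_const_mul, e31, e22, e13, hS0, hX0]
    ring

theorem aux_sum {X : ℕ → Ω → ℝ} (hX : ∀ j, Measurable (X j))
    (hX4 : ∀ j, Integrable (fun ω => X j ω ^ 4) ℙ) (hi : iIndepFun X ℙ)
    (hX0 : ∀ j, ∫ ω, X j ω ∂ℙ = 0) (D : ℝ) (hD : 1 ≤ D)
    (h2 : ∀ j, ∫ ω, X j ω ^ 2 ∂ℙ ≤ D) (h4 : ∀ j, ∫ ω, X j ω ^ 4 ∂ℙ ≤ D) (m : ℕ) :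
    Integrable (fun ω => (∑ j ∈ Finset.Icc 1 m, X j ω) ^ 4) ℙ ∧
    ∫ ω, (∑ j ∈ Finset.Icc 1 m, X j ω) ∂ℙ = 0 ∧
    ∫ ω, (∑ j ∈ Finset.Icc 1 m, X j ω) ^ 2 ∂ℙ ≤ m * D ∧
    ∫ ω, (∑ j ∈ Finset.Icc 1 m, X j ω) ^ 4 ∂ℙ ≤ 3 * m ^ 2 * D ^ 2 := by
  induction m with
  | zero => simp
  | succ m ih =>
    obtain ⟨i1, i2, i3, i4⟩ := ih
    have hS : Measurable (fun ω => ∑ j ∈ Finset.Icc 1 m, X j ω) := by fun_prop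
    have hind : IndepFun (fun ω => ∑ j ∈ Finset.Icc 1 m, X j ω) (X (m + 1)) ℙ := by
      have := hi.indepFun_finsetSum_of_notMem hX (s := Finset.Icc 1 m) (i := m + 1) (by simp)
      convert this using 1
      funext ω; simp
    obtain ⟨s1, s2, s4⟩ := aux_step hS (hX (m + 1)) i1 (hX4 (m + 1)) hind i2 (hX0 (m + 1))
    simp only [Finset.sum_Icc_succ_top (Nat.le_add_left 1 m)]
    refine ⟨aux_int_add hS (hX (m + 1)) i1 (hX4 (m + 1)), s1, ?_, ?_⟩
    · rw [s2]; push_cast; linarith [h2 (m + 1)]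
    · rw [s4]; push_cast
      have hx0 : 0 ≤ ∫ ω, X (m + 1) ω ^ 2 ∂ℙ := integral_nonneg fun ω => by positivity
      have := mul_le_mul i3 (h2 (m + 1)) hx0 (by positivity)
      nlinarith [h4 (m + 1), sq_nonneg (D - 1), mul_self_nonneg D]

theorem aux_sqrt (N : ℕ) :
    ∑ k ∈ Finset.Icc 1 N, (√(k : ℝ))⁻¹ ≤ 2 * √(N : ℝ) := by
  induction N with
  | zero => simp
  | succ N ih =>
    rw [Finset.sum_Icc_succ_top (Nat.le_add_left 1 N)]
    have ha := Real.sq_sqrt (Nat.cast_nonneg (α := ℝ) N)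
    have hb := Real.sq_sqrt (Nat.cast_nonneg (α := ℝ) (N + 1))
    have hb0 : 0 < √((N + 1 : ℕ) : ℝ) := Real.sqrt_pos.2 (by positivity)
    have ha0 := Real.sqrt_nonneg (N : ℝ)
    have hc : ((N + 1 : ℕ) : ℝ) = N + 1 := by push_cast; ring
    rw [hc] at hb hb0 ⊢
    have : (√((N : ℝ) + 1))⁻¹ ≤ 2 * (√((N : ℝ) + 1) - √(N : ℝ)) := by
      rw [inv_le_iff_one_le_mul₀ hb0]
      nlinarith [sq_nonneg (√((N : ℝ) + 1) - √(N : ℝ))]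
    linarith

theorem aux_jensen (s : Finset ℕ) (w z : ℕ → ℝ) (hw : ∀ i ∈ s, 0 ≤ w i) :
    (∑ i ∈ s, w i * z i) ^ 4 ≤ (∑ i ∈ s, w i) ^ 3 * ∑ i ∈ s, w i * z i ^ 4 := by
  rcases (Finset.sum_nonneg hw).eq_or_lt with h | h
  · have h0 := (Finset.sum_eq_zero_iff_of_nonneg hw).1 h.symm
    rw [Finset.sum_eq_zero (fun i hi => by rw [h0 i hi, zero_mul]), ← h]
    simp
  · set W := ∑ i ∈ s, w i with hW
    have := Real.pow_arith_mean_le_arith_mean_pow_of_even s (fun i => W⁻¹ * w i) z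
      (fun i hi => mul_nonneg (inv_nonneg.2 h.le) (hw i hi))
      (by rw [← Finset.mul_sum, ← hW, inv_mul_cancel₀ h.ne']) (n := 4) (by decide)
    simp only [mul_assoc] at this
    rw [← Finset.mul_sum, ← Finset.mul_sum, mul_pow] at this
    have h2 := mul_le_mul_of_nonneg_left this (pow_nonneg h.le 4)
    have e1 : W ^ 4 * (W⁻¹ ^ 4 * (∑ i ∈ s, w i * z i) ^ 4) = (∑ i ∈ s, w i * z i) ^ 4 := by
      field_simp
    have e2 : W ^ 4 * (W⁻¹ * ∑ i ∈ s, w i * z i ^ 4) = W ^ 3 * ∑ i ∈ s, w i * z i ^ 4 := by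
      field_simp
    rwa [e1, e2] at h2

theorem aux_avg (S : ℕ → Ω → ℝ) (hS : ∀ k, Measurable (S k))
    (hS4 : ∀ k, Integrable (fun ω => S k ω ^ 4) ℙ) (C : ℝ) (hC : 0 ≤ C)
    (hb : ∀ k : ℕ, ∫ ω, S k ω ^ 4 ∂ℙ ≤ C * k ^ 2) (N : ℕ) :
    Integrable (fun ω => (∑ k ∈ Finset.Icc 1 N, (k : ℝ)⁻¹ * S k ω) ^ 4) ℙ ∧
    ∫ ω, (∑ k ∈ Finset.Icc 1 N, (k : ℝ)⁻¹ * S k ω) ^ 4 ∂ℙ ≤ 16 * C * N ^ 2 := by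
  set W := ∑ k ∈ Finset.Icc 1 N, (√(k : ℝ))⁻¹ with hW
  have hW0 : 0 ≤ W := Finset.sum_nonneg fun i _ => by positivity
  have key : ∀ ω, (∑ k ∈ Finset.Icc 1 N, (k : ℝ)⁻¹ * S k ω) ^ 4 ≤
      W ^ 3 * ∑ k ∈ Finset.Icc 1 N, (√(k : ℝ))⁻¹ * (((k : ℝ) ^ 2)⁻¹ * S k ω ^ 4) := by
    intro ω
    have := aux_jensen (Finset.Icc 1 N) (fun k => (√(k : ℝ))⁻¹)
      (fun k => (√(k : ℝ))⁻¹ * S k ω) (fun i _ => by positivity)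
    convert this using 2
    · refine Finset.sum_congr rfl fun k _ => ?_
      rw [← mul_assoc, ← mul_inv, Real.mul_self_sqrt (Nat.cast_nonneg k)]
    · refine Finset.sum_congr rfl fun k _ => ?_
      have : (√(k : ℝ)) ^ 4 = (k : ℝ) ^ 2 := by
        rw [show 4 = 2 * 2 by norm_num, pow_mul, Real.sq_sqrt (Nat.cast_nonneg k)]
      rw [mul_pow, inv_pow, this]
  have hI : ∀ k ∈ Finset.Icc 1 N,
      Integrable (fun ω => (√(k : ℝ))⁻¹ * (((k : ℝ) ^ 2)⁻¹ * S k ω ^ 4)) ℙ :=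
    fun k _ => ((hS4 k).const_mul _).const_mul _
  have hI2 := (integrable_finsetSum _ hI).const_mul (W ^ 3)
  have hint : Integrable (fun ω => (∑ k ∈ Finset.Icc 1 N, (k : ℝ)⁻¹ * S k ω) ^ 4) ℙ := by
    refine hI2.mono' (by fun_prop) (Eventually.of_forall fun ω => ?_)
    rw [Real.norm_of_nonneg (by positivity)]
    exact key ω
  refine ⟨hint, (integral_mono hint hI2 key).trans ?_⟩
  rw [integral_const_mul, integral_finsetSum _ hI]
  have h1 : ∑ k ∈ Finset.Icc 1 N, ∫ ω, (√(k : ℝ))⁻¹ * (((k : ℝ) ^ 2)⁻¹ * S k ω ^ 4) ∂ℙ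
      ≤ W * C := by
    rw [hW, Finset.sum_mul]
    refine Finset.sum_le_sum fun k hk => ?_
    rw [integral_const_mul, integral_const_mul]
    have hk1 : 1 ≤ k := (Finset.mem_Icc.1 hk).1
    have hk0 : (0 : ℝ) < (k : ℝ) ^ 2 := by positivity
    refine mul_le_mul_of_nonneg_left ?_ (by positivity)
    rw [inv_mul_le_iff₀ hk0]
    linarith [hb k]
  calc _ ≤ W ^ 3 * (W * C) := mul_le_mul_of_nonneg_left h1 (by positivity)
    _ = C * W ^ 4 := by ring
    _ ≤ C * (2 * √(N : ℝ)) ^ 4 :=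
      mul_le_mul_of_nonneg_left (pow_le_pow_left₀ hW0 (aux_sqrt N) 4) hC
    _ = 16 * C * N ^ 2 := by
      have : (√(N : ℝ)) ^ 4 = (N : ℝ) ^ 2 := by
        rw [show 4 = 2 * 2 by norm_num, pow_mul, Real.sq_sqrt (Nat.cast_nonneg N)]
      rw [mul_pow, this]; ring

theorem aux_as (Y : ℕ → Ω → ℝ) (hY : ∀ n, Measurable (Y n))
    (hY4 : ∀ n, Integrable (fun ω => Y n ω ^ 4) ℙ) (b : ℕ → ℝ)
    (hb : Summable b) (h : ∀ n, ∫ ω, Y n ω ^ 4 ∂ℙ ≤ b n) :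
    ∀ᵐ ω ∂(ℙ : Measure Ω), Tendsto (fun n => Y n ω) atTop (nhds 0) := by
  have hm : ∀ n, Measurable (fun ω => ENNReal.ofReal (Y n ω ^ 4)) := fun n => by fun_prop
  have hfin : ∫⁻ ω, ∑' n, ENNReal.ofReal (Y n ω ^ 4) ∂ℙ ≠ ⊤ := by
    rw [lintegral_tsum (fun n => (hm n).aemeasurable)]
    refine ne_top_of_le_ne_top hb.tsum_ofReal_ne_top (ENNReal.tsum_le_tsum fun n => ?_)
    rw [← ofReal_integral_eq_lintegral_ofReal (hY4 n)
      (Eventually.of_forall fun ω => by positivity)]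
    exact ENNReal.ofReal_le_ofReal (h n)
  filter_upwards [ae_lt_top (Measurable.ennreal_tsum hm) hfin] with ω hω
  have h1 := ENNReal.tendsto_atTop_zero_of_tsum_ne_top hω.ne
  have h2 : Tendsto (fun n => Y n ω ^ 4) atTop (nhds 0) := by
    have := (ENNReal.tendsto_toReal ENNReal.zero_ne_top).comp h1
    refine (this.congr fun n => ?_)
    exact ENNReal.toReal_ofReal (by positivity)
  have h3 := h2.sqrt.sqrt
  simp only [Real.sqrt_zero] at h3
  rw [tendsto_zero_iff_abs_tendsto_zero]
  refine h3.congr fun n => ?_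
  rw [show Y n ω ^ 4 = (Y n ω ^ 2) ^ 2 by ring, Real.sqrt_sq (by positivity), Real.sqrt_sq_eq_abs]
  rfl

theorem aux_center {f : Ω → ℝ} (hf : Measurable f) (h4 : Integrable (fun ω => f ω ^ 4) ℙ)
    (M : ℝ) (hM : ∫ ω, f ω ^ 4 ∂ℙ ≤ M) :
    Integrable (fun ω => (f ω - ∫ ω', f ω' ∂ℙ) ^ 4) ℙ ∧
    ∫ ω, (f ω - ∫ ω', f ω' ∂ℙ) ∂ℙ = 0 ∧
    ∫ ω, (f ω - ∫ ω', f ω' ∂ℙ) ^ 2 ∂ℙ ≤ 1 + 8 * (M + (1 + M) ^ 4) ∧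
    ∫ ω, (f ω - ∫ ω', f ω' ∂ℙ) ^ 4 ∂ℙ ≤ 1 + 8 * (M + (1 + M) ^ 4) := by
  set c := ∫ ω', f ω' ∂ℙ with hc
  have i1 : Integrable f ℙ := by simpa using aux_int_pow hf h4 1 (by norm_num)
  have iD : Integrable (fun ω => (f ω - c) ^ 4) ℙ := by
    have := aux_int_add hf (measurable_const (a := -c)) h4 (integrable_const _)
    simpa only [← sub_eq_add_neg] using this
  have hcb : |c| ≤ 1 + M := by
    calc |c| ≤ ∫ ω, |f ω| ∂ℙ := abs_integral_le_integral_abs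
      _ ≤ ∫ ω, (1 + f ω ^ 4) ∂ℙ := integral_mono i1.abs ((integrable_const _).add h4)
          fun ω => by simpa using aux_abs_pow (f ω) 1 (by norm_num)
      _ ≤ 1 + M := by
        rw [integral_add (integrable_const _) h4]; simpa using hM
  have hc4 : c ^ 4 ≤ (1 + M) ^ 4 := by
    have := pow_le_pow_left₀ (abs_nonneg c) hcb 4
    rwa [← abs_pow, abs_of_nonneg (by positivity)] at this
  have hd4 : ∫ ω, (f ω - c) ^ 4 ∂ℙ ≤ 8 * (M + (1 + M) ^ 4) := by
    calc ∫ ω, (f ω - c) ^ 4 ∂ℙ ≤ ∫ ω, 8 * (f ω ^ 4 + c ^ 4) ∂ℙ :=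
          integral_mono iD ((h4.add (integrable_const _)).const_mul 8) fun ω => by
            have := aux_add4 (f ω) (-c)
            rw [← sub_eq_add_neg] at this
            simpa [Even.neg_pow (by decide : Even 4)] using this
      _ = 8 * (∫ ω, f ω ^ 4 ∂ℙ + c ^ 4) := by
          rw [integral_const_mul, integral_add h4 (integrable_const _)]; simp
      _ ≤ _ := by linarith
  refine ⟨iD, ?_, ?_, by linarith⟩
  · rw [integral_sub i1 (integrable_const _)]; simp [hc]
  · calc ∫ ω, (f ω - c) ^ 2 ∂ℙ ≤ ∫ ω, (1 + (f ω - c) ^ 4) ∂ℙ :=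
          integral_mono (aux_int_pow (by fun_prop) iD 2 (by norm_num))
            ((integrable_const _).add iD)
            fun ω => (le_abs_self _).trans (aux_abs_pow _ 2 (by norm_num))
      _ = 1 + ∫ ω, (f ω - c) ^ 4 ∂ℙ := by
          rw [integral_add (integrable_const _) iD]; simp
      _ ≤ _ := by linarith

end Aux

theorem stmt5
    {Ω : Type*} [MeasureSpace Ω] [IsProbabilityMeasure (ℙ : Measure Ω)]
    (ξ : ℕ → ℕ → ℕ → Ω → ℝ)  -- ξ n k j
    (hmeas : ∀ n k j, Measurable (ξ n k j))
    (hindep : ∀ n, iIndep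
      (fun j : ℕ => ⨆ k : ℕ, MeasurableSpace.comap (ξ n k j) (borel ℝ)) ℙ)
    (M : ℝ)
    (hmom : ∀ n k j, ∫ ω, (ξ n k j ω) ^ 4 ∂ℙ ≤ M)
    (hint : ∀ n k j, Integrable (fun ω => (ξ n k j ω) ^ 4) ℙ)
    (K : ℝ) (hK : 0 < K)
    (Kn : ℕ → ℕ) (hKn0 : ∀ n, 0 < Kn n)
    (hKn : Tendsto (fun n => (Kn n : ℝ) / n) atTop (nhds K)) :
    ∀ᵐ ω ∂(ℙ : Measure Ω),
      Tendsto (fun n : ℕ =>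
        (n : ℝ)⁻¹ *
          ∑ k ∈ Finset.Icc 1 (Kn n), (k : ℝ)⁻¹ *
            ((∑ j ∈ Finset.Icc 1 k, ξ n k j ω)
              - ∫ ω', (∑ j ∈ Finset.Icc 1 k, ξ n k j ω') ∂ℙ))
        atTop (nhds 0) := by
  have hM0 : 0 ≤ M := (integral_nonneg fun ω => by positivity).trans (hmom 0 0 0)
  obtain ⟨D, hDdef⟩ : ∃ D : ℝ, D = 1 + 8 * (M + (1 + M) ^ 4) := ⟨_, rfl⟩
  have hD1 : 1 ≤ D := by rw [hDdef]; nlinarith [pow_nonneg (by linarith : 0 ≤ 1 + M) 4]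
  have hcen := fun n k j => aux_center (hmeas n k j) (hint n k j) M (hmom n k j)
  simp only [← hDdef] at hcen
  have hint1 : ∀ n k j, Integrable (ξ n k j) ℙ := fun n k j => by
    simpa using aux_int_pow (hmeas n k j) (hint n k j) 1 (by norm_num)
  have hind : ∀ n k, iIndepFun (fun j ω => ξ n k j ω - ∫ ω', ξ n k j ω' ∂ℙ) ℙ := by
    intro n k
    have h1 : iIndepFun (fun j => ξ n k j) ℙ := by
      rw [iIndepFun_iff_iIndep]
      refine iIndep_of_iIndep_of_le (hindep n) fun j => ?_
      rw [BorelSpace.measurable_eq (α := ℝ)]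
      exact le_iSup (fun k => MeasurableSpace.comap (ξ n k j) (borel ℝ)) k
    exact h1.comp (fun j x => x - ∫ ω', ξ n k j ω' ∂ℙ) fun j => by fun_prop
  have hsum := fun n k => aux_sum (X := fun j ω => ξ n k j ω - ∫ ω', ξ n k j ω' ∂ℙ)
    (fun j => (hmeas n k j).sub_const _) (fun j => (hcen n k j).1) (hind n k)
    (fun j => (hcen n k j).2.1) D hD1 (fun j => (hcen n k j).2.2.1)
    (fun j => (hcen n k j).2.2.2) k
  have hrw : ∀ n k ω, (∑ j ∈ Finset.Icc 1 k, ξ n k j ω)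
      - ∫ ω', (∑ j ∈ Finset.Icc 1 k, ξ n k j ω') ∂ℙ
      = ∑ j ∈ Finset.Icc 1 k, (ξ n k j ω - ∫ ω', ξ n k j ω' ∂ℙ) := by
    intro n k ω
    rw [integral_finsetSum _ (fun j _ => hint1 n k j), Finset.sum_sub_distrib]
  simp only [hrw]
  have havg := fun n => aux_avg
    (fun k ω => ∑ j ∈ Finset.Icc 1 k, (ξ n k j ω - ∫ ω', ξ n k j ω' ∂ℙ))
    (fun k => by fun_prop) (fun k => (hsum n k).1) (3 * D ^ 2) (by positivity)
    (fun k => (hsum n k).2.2.2.trans_eq (by ring)) (Kn n)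
  obtain ⟨B, hB⟩ := hKn.bddAbove_range
  have hB' : ∀ n, (Kn n : ℝ) / n ≤ B := fun n => hB ⟨n, rfl⟩
  refine aux_as _ (fun n => by fun_prop)
    (fun n => ?_) (fun n : ℕ => (48 * D ^ 2 * B ^ 2) * (1 / (n : ℝ) ^ 2))
    ((Real.summable_one_div_nat_pow.2 (by norm_num)).mul_left _) (fun n => ?_)
  · simp only [mul_pow]
    exact (havg n).1.const_mul _
  · simp only [mul_pow]
    rw [integral_const_mul]
    rcases Nat.eq_zero_or_pos n with rfl | hn
    · simp
    · have hn0 : (0 : ℝ) < n := by exact_mod_cast hn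
      have h1 : ((Kn n : ℝ) / n) ^ 2 ≤ B ^ 2 :=
        pow_le_pow_left₀ (by positivity) (hB' n) 2
      calc _ ≤ (n : ℝ)⁻¹ ^ 4 * (16 * (3 * D ^ 2) * (Kn n : ℝ) ^ 2) :=
            mul_le_mul_of_nonneg_left (havg n).2 (by positivity)
        _ = (48 * D ^ 2 * (1 / (n : ℝ) ^ 2)) * ((Kn n : ℝ) / n) ^ 2 := by
            field_simp; ring
        _ ≤ (48 * D ^ 2 * (1 / (n : ℝ) ^ 2)) * B ^ 2 :=
            mul_le_mul_of_nonneg_left h1 (by positivity)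
        _ = _ := by ring
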